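/- arXiv:2211.06602 — 5 statements merged into one kernel-verified Lean document; each statement's English description precedes it below -/
import Mathlib

section
/- The Lebesgue integral over ℝ of the complex-valued function x ↦ x/((x−i)⁵(x+i)³) equals 5πi/64. -/
open Real Complex MeasureTheory

open Filter Topology

lemma ofReal_add_ne_zero {c : ℂ} (hc : c.im ≠ 0) (x : ℝ) : (x : ℂ) + c ≠ 0 := fun h ↦
  hc (by simpa using congrArg Complex.im h)

lemma hasDerivAt_inv_ofReal_add {c : ℂ} (hc : c.im ≠ 0) (x : ℝ) :
    HasDerivAt (fun y : ℝ ↦ ((y : ℂ) + c)⁻¹) (-1 / ((x : ℂ) + c) ^ 2) x :=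
  (Complex.ofRealCLM.hasDerivAt.add_const c).fun_inv (ofReal_add_ne_zero hc x)

lemma tendsto_inv_ofReal_add_cocompact (c : ℂ) :
    Tendsto (fun x : ℝ ↦ ((x : ℂ) + c)⁻¹) (cocompact ℝ) (𝓝 0) :=
  Metric.cobounded_eq_cocompact (α := ℝ) ▸ tendsto_inv₀_cobounded.comp
    ((tendsto_add_const_cobounded c).comp (RCLike.tendsto_ofReal_cobounded_cobounded ℂ))

lemma norm_ofReal_sub_I (x : ℝ) : ‖(x : ℂ) - I‖ = √(1 + x ^ 2) := by
  rw [Complex.norm_def]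
  congr 1
  simp [normSq_apply]
  ring

lemma norm_ofReal_add_I (x : ℝ) : ‖(x : ℂ) + I‖ = √(1 + x ^ 2) := by
  rw [Complex.norm_def]
  congr 1
  simp [normSq_apply]
  ring

lemma integrable_div_sub_I_pow_mul_add_I_pow :
    Integrable fun x : ℝ ↦ (x : ℂ) / (((x : ℂ) - I) ^ 5 * ((x : ℂ) + I) ^ 3) := by
  refine integrable_inv_one_add_sq.mono' (Measurable.aestronglyMeasurable (by fun_prop)) (ae_of_all _ fun x ↦ ?_)
  have hpos : 0 < 1 + x ^ 2 := by positivity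
  have hx : |x| ≤ 1 + x ^ 2 := by nlinarith [sq_abs x, sq_nonneg (|x| - 1)]
  have hs : √(1 + x ^ 2) ^ 5 * √(1 + x ^ 2) ^ 3 = (1 + x ^ 2) ^ 4 := by
    rw [← pow_add, show 5 + 3 = 2 * 4 from rfl, pow_mul, Real.sq_sqrt hpos.le]
  rw [norm_div, norm_mul, norm_pow, norm_pow, norm_ofReal_sub_I, norm_ofReal_add_I, hs,
    Complex.norm_real, Real.norm_eq_abs, inv_eq_one_div, div_le_div_iff₀ (by positivity) hpos]
  calc |x| * (1 + x ^ 2) ≤ (1 + x ^ 2) * (1 + x ^ 2) := by gcongr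
    _ = (1 + x ^ 2) ^ 2 := by ring
    _ ≤ (1 + x ^ 2) ^ 4 := pow_le_pow_right₀ (by nlinarith [sq_nonneg x]) (by norm_num)
    _ = 1 * (1 + x ^ 2) ^ 4 := by ring

/-- The rational part of an antiderivative of `x / ((x - i)⁵ (x + i)³)`, as a polynomial in
`u = 1 / (x - i)` and `v = 1 / (x + i)`. -/
noncomputable def rationalPart (u v : ℂ) : ℂ :=
  (4 * I * u + 8 * I / 3 * u ^ 3 + 4 * u ^ 4 + 6 * I * v - 2 * v ^ 2) / 128

noncomputable def antiderivative (x : ℝ) : ℂ :=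
  5 * I / 64 * (Real.arctan x : ℂ) + rationalPart ((x : ℂ) + -I)⁻¹ ((x : ℂ) + I)⁻¹

lemma hasDerivAt_antiderivative (x : ℝ) :
    HasDerivAt antiderivative ((x : ℂ) / (((x : ℂ) - I) ^ 5 * ((x : ℂ) + I) ^ 3)) x := by
  have hu := hasDerivAt_inv_ofReal_add (c := -I) (by simp) x
  have hv := hasDerivAt_inv_ofReal_add (c := I) (by simp) x
  have ha : HasDerivAt (fun y : ℝ ↦ (Real.arctan y : ℂ)) ((1 / (1 + x ^ 2) : ℝ) : ℂ) x :=
    (Real.hasDerivAt_arctan x).ofReal_comp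
  have h := (ha.const_mul (5 * I / 64)).fun_add
    ((((((hu.const_mul (4 * I)).fun_add ((hu.fun_pow 3).const_mul (8 * I / 3))).fun_add
      ((hu.fun_pow 4).const_mul 4)).fun_add (hv.const_mul (6 * I))).fun_sub
      ((hv.fun_pow 2).const_mul 2)).div_const 128)
  refine h.congr_deriv ?_
  have h₁ : (x : ℂ) + -I ≠ 0 := ofReal_add_ne_zero (by simp) x
  have h₂ : (x : ℂ) + I ≠ 0 := ofReal_add_ne_zero (by simp) x
  have hsq : 1 + (x : ℂ) ^ 2 = (x + -I) * (x + I) := by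
    linear_combination I_sq
  push_cast
  rw [hsq, sub_eq_add_neg (x : ℂ) I]
  generalize hp : (x : ℂ) + -I = p at *
  generalize hq : (x : ℂ) + I = q at *
  have hx : (x : ℂ) = (p + q) / 2 := by rw [← hp, ← hq]; ring
  have hqp : q = p + 2 * I := by rw [← hp, ← hq]; ring
  rw [hx]
  field_simp
  subst hqp
  ring_nf
  simp only [I_sq, I_pow_three, I_pow_four]
  ring_nf

lemma tendsto_antiderivative {l : Filter ℝ} (hl : l ≤ cocompact ℝ) {a : ℝ}
    (ha : Tendsto Real.arctan l (𝓝 a)) : Tendsto antiderivative l (𝓝 (5 * I / 64 * a)) := by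
  have hr : Continuous fun p : ℂ × ℂ ↦ rationalPart p.1 p.2 := by
    unfold rationalPart
    fun_prop
  have huv := ((tendsto_inv_ofReal_add_cocompact (-I)).mono_left hl).prodMk_nhds
    ((tendsto_inv_ofReal_add_cocompact I).mono_left hl)
  have h := (((continuous_ofReal.tendsto a).comp ha).const_mul (5 * I / 64)).add
    ((hr.tendsto (0, 0)).comp huv)
  have h₀ : rationalPart 0 0 = 0 := by simp [rationalPart]
  simp only [h₀, add_zero] at h
  exact h

theorem integral_phi3_a :
    ∫ x : ℝ, ((x : ℂ)) / (((x : ℂ) - I) ^ 5 * ((x : ℂ) + I) ^ 3) = 5 * (π : ℂ) * I / 64 := by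
  rw [integral_of_hasDerivAt_of_tendsto hasDerivAt_antiderivative
    integrable_div_sub_I_pow_mul_add_I_pow
    (tendsto_antiderivative atBot_le_cocompact
      (tendsto_nhds_of_tendsto_nhdsWithin tendsto_arctan_atBot))
    (tendsto_antiderivative atTop_le_cocompact
      (tendsto_nhds_of_tendsto_nhdsWithin tendsto_arctan_atTop))]
  push_cast
  ring
end

section
/- The Lebesgue integral over ℝ of the complex-valued function x ↦ (2 + ix)(3x² − 1)/((x−i)⁵(x+i)³) equals 5π/16. -/
open Real Complex MeasureTheory

lemma one_add_sq_eq_sub_I_mul_add_I (z : ℂ) : 1 + z ^ 2 = (z - I) * (z + I) := by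
  linear_combination I_sq

lemma ofReal_sub_ne_zero {z : ℂ} (hz : z.im ≠ 0) (x : ℝ) : (x : ℂ) - z ≠ 0 := by
  intro h
  apply hz
  simpa using congrArg Complex.im h

lemma hasDerivAt_inv_ofReal_sub {z : ℂ} (hz : z.im ≠ 0) (x : ℝ) :
    HasDerivAt (fun t : ℝ => ((t : ℂ) - z)⁻¹) (-((x : ℂ) - z)⁻¹ ^ 2) x := by
  have h := ((hasDerivAt_id x).ofReal_comp.sub_const z).fun_inv (ofReal_sub_ne_zero hz x)
  simpa [div_eq_mul_inv] using h

lemma norm_inv_ofReal_sub_le {z : ℂ} (hz : 1 ≤ |z.im|) (x : ℝ) :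
    ‖((x : ℂ) - z)⁻¹‖ ≤ 1 := by
  rw [norm_inv]
  apply inv_le_one_of_one_le₀
  have h := Complex.abs_im_le_norm ((x : ℂ) - z)
  simp only [Complex.sub_im, Complex.ofReal_im, zero_sub, abs_neg] at h
  exact hz.trans h

lemma tendsto_inv_ofReal_sub {l : Filter ℝ} (hl : l ≤ Bornology.cobounded ℝ) (z : ℂ) :
    Filter.Tendsto (fun x : ℝ => ((x : ℂ) - z)⁻¹) l (nhds 0) :=
  Filter.tendsto_inv₀_cobounded.comp ((tendsto_sub_const_cobounded z).comp
    ((RCLike.tendsto_ofReal_cobounded_cobounded ℂ).mono_left hl))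

/-- An antiderivative of the integrand, as a combination of `arctan` and of powers of `(x ∓ i)⁻¹`. -/
noncomputable def phiPrimitive (x : ℝ) : ℂ :=
  5 / 16 * (Real.arctan x : ℂ) + (1 / 4 * ((x : ℂ) - -I)⁻¹ + 3 * I / 16 * ((x : ℂ) - -I)⁻¹ ^ 2 +
    1 / 16 * ((x : ℂ) - I)⁻¹ - 1 / 6 * ((x : ℂ) - I)⁻¹ ^ 3 + I / 8 * ((x : ℂ) - I)⁻¹ ^ 4)

lemma hasDerivAt_phiPrimitive (x : ℝ) :
    HasDerivAt phiPrimitive (((2 + I * (x : ℂ)) * (3 * (x : ℂ) ^ 2 - 1)) /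
      (((x : ℂ) - I) ^ 5 * ((x : ℂ) + I) ^ 3)) x := by
  have hI : I.im ≠ 0 := by simp
  have hI' : (-I).im ≠ 0 := by simp
  have hu := hasDerivAt_inv_ofReal_sub hI x
  have hv := hasDerivAt_inv_ofReal_sub hI' x
  have ha := (Real.hasDerivAt_arctan x).ofReal_comp
  have h := (ha.const_mul (5 / 16 : ℂ)).fun_add (((((hv.const_mul (1 / 4 : ℂ)).fun_add
    ((hv.fun_pow 2).const_mul (3 * I / 16))).fun_add (hu.const_mul (1 / 16 : ℂ))).fun_sub
    ((hu.fun_pow 3).const_mul (1 / 6 : ℂ))).fun_add ((hu.fun_pow 4).const_mul (I / 8)))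
  refine h.congr_deriv ?_
  have h1 := ofReal_sub_ne_zero hI x
  have h2 := ofReal_sub_ne_zero hI' x
  rw [sub_neg_eq_add] at h2 ⊢
  push_cast
  rw [one_add_sq_eq_sub_I_mul_add_I]
  generalize (x : ℂ) = y at *
  obtain ⟨w, rfl⟩ : ∃ w, y = w + I := ⟨y - I, by ring⟩
  rw [add_sub_cancel_right] at *
  field_simp
  ring_nf
  simp only [I_sq, I_pow_three, I_pow_four]
  ring

lemma tendsto_phiPrimitive {l : Filter ℝ} (hl : l ≤ Bornology.cobounded ℝ) {a : ℝ}
    (ha : Filter.Tendsto Real.arctan l (nhds a)) :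
    Filter.Tendsto phiPrimitive l (nhds (5 / 16 * (a : ℂ))) := by
  have hu := tendsto_inv_ofReal_sub hl I
  have hv := tendsto_inv_ofReal_sub hl (-I)
  have ha' : Filter.Tendsto (fun x => (Real.arctan x : ℂ)) l (nhds (a : ℂ)) :=
    (Complex.continuous_ofReal.tendsto a).comp ha
  have h := (ha'.const_mul (5 / 16 : ℂ)).add (((((hv.const_mul (1 / 4 : ℂ)).add
    ((hv.pow 2).const_mul (3 * I / 16))).add (hu.const_mul (1 / 16 : ℂ))).sub
    ((hu.pow 3).const_mul (1 / 6 : ℂ))).add ((hu.pow 4).const_mul (I / 8)))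
  simpa [funext phiPrimitive.eq_1] using h

lemma integrable_phi : Integrable fun x : ℝ => ((2 + I * (x : ℂ)) * (3 * (x : ℂ) ^ 2 - 1)) /
    (((x : ℂ) - I) ^ 5 * ((x : ℂ) + I) ^ 3) := by
  have hu : Continuous fun x : ℝ => ((x : ℂ) - I)⁻¹ :=
    (Complex.continuous_ofReal.sub continuous_const).inv₀ (ofReal_sub_ne_zero (by simp))
  have hv : Continuous fun x : ℝ => ((x : ℂ) - -I)⁻¹ :=
    (Complex.continuous_ofReal.sub continuous_const).inv₀ (ofReal_sub_ne_zero (by simp))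
  have hg : Continuous fun x : ℝ => ((x : ℂ) - I)⁻¹ ^ 3 * (I + 3 * ((x : ℂ) - -I)⁻¹) *
      (3 - 4 * (((x : ℂ) - I)⁻¹ * ((x : ℂ) - -I)⁻¹)) := by fun_prop
  have hb (x : ℝ) : ‖((x : ℂ) - I)⁻¹ ^ 3 * (I + 3 * ((x : ℂ) - -I)⁻¹) *
      (3 - 4 * (((x : ℂ) - I)⁻¹ * ((x : ℂ) - -I)⁻¹))‖ ≤ 1 ^ 3 * (1 + 3 * 1) * (3 + 4 * (1 * 1)) := by
    have h1 := norm_inv_ofReal_sub_le (z := I) (by simp) x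
    have h2 := norm_inv_ofReal_sub_le (z := -I) (by simp) x
    rw [norm_mul, norm_mul, norm_pow]
    gcongr
    · refine (norm_add_le _ _).trans ?_
      rw [norm_mul, Complex.norm_I, Complex.norm_ofNat]
      gcongr
    · refine (norm_sub_le _ _).trans ?_
      rw [norm_mul, norm_mul, Complex.norm_ofNat, Complex.norm_ofNat]
      gcongr
  refine ((integrable_inv_one_add_sq.ofReal (𝕜 := ℂ)).bdd_mul hg.aestronglyMeasurable
    (Filter.Eventually.of_forall hb)).congr (Filter.Eventually.of_forall fun x => ?_)
  have h1 : (x : ℂ) - I ≠ 0 := ofReal_sub_ne_zero (by simp) x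
  have h2 : (x : ℂ) - -I ≠ 0 := ofReal_sub_ne_zero (by simp) x
  rw [sub_neg_eq_add] at h2
  simp only [sub_neg_eq_add, RCLike.ofReal_eq_complex_ofReal]
  push_cast
  rw [one_add_sq_eq_sub_I_mul_add_I]
  generalize (x : ℂ) = y at *
  have h4 : 3 * y ^ 2 - 1 = 3 * ((y - I) * (y + I)) - 4 := by linear_combination 3 * I_sq
  have h5 : 2 + I * y = I * (y + I) + 3 := by linear_combination -I_sq
  rw [h4, h5]
  field_simp

theorem integral_phi1_b :
    ∫ x : ℝ, (((2 + I * (x : ℂ)) * (3 * (x : ℂ) ^ 2 - 1))) / (((x : ℂ) - I) ^ 5 * ((x : ℂ) + I) ^ 3) = 5 * (π : ℂ) / 16 := by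
  rw [integral_of_hasDerivAt_of_tendsto hasDerivAt_phiPrimitive integrable_phi
    (tendsto_phiPrimitive IsOrderBornology.atBot_le_cobounded
      (tendsto_nhds_of_tendsto_nhdsWithin tendsto_arctan_atBot))
    (tendsto_phiPrimitive IsOrderBornology.atTop_le_cobounded
      (tendsto_nhds_of_tendsto_nhdsWithin tendsto_arctan_atTop))]
  push_cast
  ring
end

section
/- The Lebesgue integral over ℝ of the complex-valued function x ↦ (5x² − 1)/((x−i)⁵(x+i)⁴) equals −5πi/64. -/
open Real Complex MeasureTheory

theorem integrable_div_one_add_sq_pow_five {p : ℝ → ℝ} (hp : Continuous p)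
    (hbound : ∀ x, |p x| ≤ 5 * (1 + x ^ 2) ^ 4) :
    Integrable fun x : ℝ ↦ p x / (1 + x ^ 2) ^ 5 := by
  refine (integrable_inv_one_add_sq.const_mul 5).mono' ?_ (.of_forall fun x ↦ ?_)
  · exact (hp.div₀ (by fun_prop) fun x ↦ by positivity).aestronglyMeasurable
  · have hu : 0 < 1 + x ^ 2 := by positivity
    rw [norm_eq_abs, abs_div, abs_of_pos (pow_pos hu 5), div_le_iff₀ (pow_pos hu 5)]
    refine (hbound x).trans_eq ?_
    field_simp

theorem tendsto_div_one_add_sq_pow {l : Filter ℝ} (hl : Filter.Tendsto (·⁻¹) l (nhds (0 : ℝ)))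
    (k : ℕ) : Filter.Tendsto (fun x : ℝ ↦ x / (1 + x ^ 2) ^ (k + 1)) l (nhds 0) := by
  have hc : Continuous fun y : ℝ ↦ y ^ (2 * k + 1) / (1 + y ^ 2) ^ (k + 1) :=
    Continuous.div₀ (by fun_prop) (by fun_prop) fun y ↦ by positivity
  have h := (hc.tendsto 0).comp hl
  simp only [ne_eq, Nat.add_eq_zero_iff, one_ne_zero, and_false, not_false_eq_true, zero_pow,
    zero_div] at h
  refine h.congr fun x ↦ ?_
  rcases eq_or_ne x 0 with rfl | hx
  · simp
  · have hy : 1 + x⁻¹ ^ 2 = (1 + x ^ 2) / x ^ 2 := by field_simp; ring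
    have hu : 1 + x ^ 2 ≠ 0 := by positivity
    simp only [Function.comp_apply]
    rw [hy, div_pow, inv_pow, ← pow_mul]
    field_simp
    ring

theorem hasDerivAt_div_one_add_sq_pow (k : ℕ) (x : ℝ) :
    HasDerivAt (fun x : ℝ ↦ x / (1 + x ^ 2) ^ (k + 1))
      ((1 + x ^ 2 - 2 * (k + 1) * x ^ 2) / (1 + x ^ 2) ^ (k + 2)) x := by
  have hu : 1 + x ^ 2 ≠ 0 := by positivity
  have h := (hasDerivAt_id x).div ((((hasDerivAt_id x).pow 2).const_add 1).pow (k + 1))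
    (pow_ne_zero (k + 1) hu)
  refine h.congr_deriv ?_
  simp
  field_simp
  ring

theorem integrable_five_mul_sq_sub_one_div :
    Integrable fun x : ℝ ↦ (5 * x ^ 2 - 1) / (1 + x ^ 2) ^ 5 := by
  refine integrable_div_one_add_sq_pow_five (by fun_prop) fun x ↦ ?_
  rw [abs_le]
  constructor <;> nlinarith [sq_nonneg x, sq_nonneg (x ^ 2), sq_nonneg (x ^ 3), sq_nonneg (x ^ 4)]

theorem integral_five_mul_sq_sub_one_div :
    ∫ x : ℝ, (5 * x ^ 2 - 1) / (1 + x ^ 2) ^ 5 = -(5 * π / 64) := by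
  have lim {l : Filter ℝ} {a : ℝ} (hl : Filter.Tendsto (·⁻¹) l (nhds (0 : ℝ)))
      (ha : Filter.Tendsto Real.arctan l (nhds a)) :=
    ((((tendsto_div_one_add_sq_pow hl 3).const_mul (-3 / 4)).add
      ((tendsto_div_one_add_sq_pow hl 2).const_mul (-1 / 24))).add
      ((tendsto_div_one_add_sq_pow hl 1).const_mul (-5 / 96))).add
      ((tendsto_div_one_add_sq_pow hl 0).const_mul (-5 / 64)) |>.add (ha.const_mul (-5 / 64))
  have deriv (x : ℝ) :=
    ((((hasDerivAt_div_one_add_sq_pow 3 x).const_mul (-3 / 4)).add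
      ((hasDerivAt_div_one_add_sq_pow 2 x).const_mul (-1 / 24))).add
      ((hasDerivAt_div_one_add_sq_pow 1 x).const_mul (-5 / 96))).add
      ((hasDerivAt_div_one_add_sq_pow 0 x).const_mul (-5 / 64)) |>.add
      ((hasDerivAt_arctan' x).const_mul (-5 / 64))
  refine (integral_of_hasDerivAt_of_tendsto (fun x ↦ (deriv x).congr_deriv ?_)
    integrable_five_mul_sq_sub_one_div
    (lim tendsto_inv_atBot_zero (tendsto_nhds_of_tendsto_nhdsWithin tendsto_arctan_atBot))
    (lim tendsto_inv_atTop_zero (tendsto_nhds_of_tendsto_nhdsWithin tendsto_arctan_atTop))).trans ?_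
  · have hu : 1 + x ^ 2 ≠ 0 := by positivity
    push_cast
    field_simp
    ring
  · ring

theorem integral_mul_five_mul_sq_sub_one_div :
    ∫ x : ℝ, x * (5 * x ^ 2 - 1) / (1 + x ^ 2) ^ 5 = 0 := by
  have h := integral_neg_eq_self (fun x : ℝ ↦ x * (5 * x ^ 2 - 1) / (1 + x ^ 2) ^ 5) volume
  simp only [even_two, Even.neg_pow, neg_mul, neg_div, integral_neg] at h
  linarith

theorem integral_phi2_a :
    ∫ x : ℝ, ((5 * (x : ℂ) ^ 2 - 1)) / (((x : ℂ) - I) ^ 5 * ((x : ℂ) + I) ^ 4) = -(5 * (π : ℂ) * I / 64) := by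
  have split (x : ℝ) : (5 * (x : ℂ) ^ 2 - 1) / (((x : ℂ) - I) ^ 5 * ((x : ℂ) + I) ^ 4) =
      ((x * (5 * x ^ 2 - 1) / (1 + x ^ 2) ^ 5 : ℝ) : ℂ) +
        (((5 * x ^ 2 - 1) / (1 + x ^ 2) ^ 5 : ℝ) : ℂ) * I := by
    have hu : (1 + (x : ℂ) ^ 2) ≠ 0 := by
      exact_mod_cast (by positivity : (1 + x ^ 2 : ℝ) ≠ 0)
    have hfac : (1 + (x : ℂ) ^ 2) = (x - I) * (x + I) := by
      linear_combination I_sq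
    rw [hfac] at hu
    have hsub := left_ne_zero_of_mul hu
    have hadd := right_ne_zero_of_mul hu
    push_cast
    rw [hfac]
    field_simp
  simp_rw [split]
  rw [integral_add, integral_mul_const, integral_complex_ofReal, integral_complex_ofReal,
    integral_mul_five_mul_sq_sub_one_div, integral_five_mul_sq_sub_one_div]
  · push_cast
    ring
  · refine (integrable_div_one_add_sq_pow_five (by fun_prop) fun x ↦ ?_).ofReal
    rw [abs_le]
    constructor <;> nlinarith [sq_nonneg x, sq_nonneg (x ^ 2), sq_nonneg (x ^ 3), sq_nonneg (x ^ 4),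
      sq_nonneg (x + 1), sq_nonneg (x - 1), sq_nonneg (x ^ 2 - x), sq_nonneg (x ^ 2 + x)]
  · exact integrable_five_mul_sq_sub_one_div.ofReal.mul_const I
end

section
/- The Lebesgue integral over ℝ of the complex-valued function x ↦ x(x² − 1)/((x−i)⁵(x+i)⁴) equals −π/64. -/
open Real Complex MeasureTheory

open Filter Topology Bornology in
/-- The fundamental theorem of calculus on the whole line for a continuous function dominated by
`(1 + x ^ 2)⁻¹`, with a primitive of the form `c * arctan x + R x` where `R` is a continuous
function of `x⁻¹` away from the origin that vanishes at infinity. -/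
lemma integral_eq_mul_pi_of_arctan_primitive {f R G : ℝ → ℝ} {c : ℝ} (hf : Continuous f)
    (hbound : ∀ x, |f x| ≤ (1 + x ^ 2)⁻¹)
    (hderiv : ∀ x, HasDerivAt (fun y => c * Real.arctan y + R y) (f x) x)
    (hG : Continuous G) (hG0 : G 0 = 0) (hRG : ∀ x, x ≠ 0 → R x = G x⁻¹) :
    Integrable f ∧ ∫ x, f x = c * π := by
  have hint : Integrable f :=
    integrable_inv_one_add_sq.mono' hf.aestronglyMeasurable (ae_of_all _ hbound)
  have hR : Tendsto R (cobounded ℝ) (𝓝 0) := by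
    have h : Tendsto (fun x => G x⁻¹) (cobounded ℝ) (𝓝 0) := by
      have := (hG.tendsto 0).comp (tendsto_inv₀_cobounded (α := ℝ))
      rwa [hG0] at this
    refine h.congr' ?_
    filter_upwards [eventually_ne_cobounded (0 : ℝ)] with x hx using (hRG x hx).symm
  have hbot : Tendsto (fun y => c * Real.arctan y + R y) atBot (𝓝 (c * (-(π / 2)) + 0)) :=
    ((tendsto_arctan_atBot.mono_right nhdsWithin_le_nhds).const_mul c).add
      (hR.mono_left (IsOrderBornology.atBot_le_cobounded))
  have htop : Tendsto (fun y => c * Real.arctan y + R y) atTop (𝓝 (c * (π / 2) + 0)) :=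
    ((tendsto_arctan_atTop.mono_right nhdsWithin_le_nhds).const_mul c).add
      (hR.mono_left (IsOrderBornology.atTop_le_cobounded))
  refine ⟨hint, ?_⟩
  rw [integral_of_hasDerivAt_of_tendsto hderiv hint hbot htop]
  ring

lemma integral_sq_mul_sq_sub_one_div_one_add_sq_pow_five :
    Integrable (fun x : ℝ => x ^ 2 * (x ^ 2 - 1) / (1 + x ^ 2) ^ 5) ∧
      ∫ x : ℝ, x ^ 2 * (x ^ 2 - 1) / (1 + x ^ 2) ^ 5 = -1 / 64 * π := by
  have hpos (x : ℝ) : 0 < 1 + x ^ 2 := by positivity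
  refine integral_eq_mul_pi_of_arctan_primitive
    (R := fun x => (3 * x - 53 * x ^ 3 - 11 * x ^ 5 - 3 * x ^ 7) / (192 * (1 + x ^ 2) ^ 4))
    (G := fun w => (3 * w ^ 7 - 53 * w ^ 5 - 11 * w ^ 3 - 3 * w) / (192 * (1 + w ^ 2) ^ 4))
    ?_ ?_ ?_ ?_ (by norm_num) ?_
  · exact Continuous.div (by fun_prop) (by fun_prop) fun x => (pow_pos (hpos x) 5).ne'
  · intro x
    have h := hpos x
    rw [abs_div, abs_of_pos (pow_pos h 5), div_le_iff₀ (pow_pos h 5),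
      show (1 + x ^ 2)⁻¹ * (1 + x ^ 2) ^ 5 = (1 + x ^ 2) ^ 4 by field_simp, abs_le]
    constructor <;> nlinarith [sq_nonneg x, sq_nonneg (x ^ 2), sq_nonneg (x ^ 3), sq_nonneg (x ^ 4)]
  · intro x
    have h := (hpos x).ne'
    have hnum : HasDerivAt (fun x : ℝ => 3 * x - 53 * x ^ 3 - 11 * x ^ 5 - 3 * x ^ 7)
        (3 - 159 * x ^ 2 - 55 * x ^ 4 - 21 * x ^ 6) x := by
      refine HasDerivAt.congr_deriv
        (((((hasDerivAt_id x).const_mul 3).sub ((hasDerivAt_pow 3 x).const_mul 53)).sub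
          ((hasDerivAt_pow 5 x).const_mul 11)).sub ((hasDerivAt_pow 7 x).const_mul 3)) ?_
      push_cast; ring
    have hden : HasDerivAt (fun x : ℝ => 192 * (1 + x ^ 2) ^ 4)
        (1536 * x * (1 + x ^ 2) ^ 3) x := by
      refine HasDerivAt.congr_deriv ((((hasDerivAt_pow 2 x).const_add 1).pow 4).const_mul 192) ?_
      push_cast; ring
    refine HasDerivAt.congr_deriv
      (((hasDerivAt_arctan x).const_mul (-1 / 64)).add (hnum.div hden (by positivity))) ?_
    field_simp
    ring
  · exact Continuous.div (by fun_prop) (by fun_prop) fun x => by positivity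
  · intro x hx
    have h := (hpos x).ne'
    have h' : x ^ 2 + 1 ≠ 0 := by positivity
    field_simp
    ring

lemma integral_mul_sq_sub_one_div_one_add_sq_pow_five :
    Integrable (fun x : ℝ => x * (x ^ 2 - 1) / (1 + x ^ 2) ^ 5) ∧
      ∫ x : ℝ, x * (x ^ 2 - 1) / (1 + x ^ 2) ^ 5 = 0 * π := by
  have hpos (x : ℝ) : 0 < 1 + x ^ 2 := by positivity
  refine integral_eq_mul_pi_of_arctan_primitive
    (R := fun x => (1 - 2 * x ^ 2) / (12 * (1 + x ^ 2) ^ 4))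
    (G := fun w => (w ^ 8 - 2 * w ^ 6) / (12 * (1 + w ^ 2) ^ 4))
    ?_ ?_ ?_ ?_ (by norm_num) ?_
  · exact Continuous.div (by fun_prop) (by fun_prop) fun x => (pow_pos (hpos x) 5).ne'
  · intro x
    have h := hpos x
    rw [abs_div, abs_of_pos (pow_pos h 5), div_le_iff₀ (pow_pos h 5),
      show (1 + x ^ 2)⁻¹ * (1 + x ^ 2) ^ 5 = (1 + x ^ 2) ^ 4 by field_simp, abs_le]
    constructor <;> nlinarith [sq_nonneg x, sq_nonneg (x ^ 2), sq_nonneg (x ^ 3),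
      sq_nonneg (x ^ 4), sq_nonneg (x - 1), sq_nonneg (x + 1), sq_nonneg (x ^ 2 - x),
      sq_nonneg (x ^ 2 + x)]
  · intro x
    have h := (hpos x).ne'
    have hnum : HasDerivAt (fun x : ℝ => 1 - 2 * x ^ 2) (-4 * x) x := by
      refine HasDerivAt.congr_deriv (((hasDerivAt_pow 2 x).const_mul 2).const_sub 1) ?_
      push_cast; ring
    have hden : HasDerivAt (fun x : ℝ => 12 * (1 + x ^ 2) ^ 4) (96 * x * (1 + x ^ 2) ^ 3) x := by
      refine HasDerivAt.congr_deriv ((((hasDerivAt_pow 2 x).const_add 1).pow 4).const_mul 12) ?_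
      push_cast; ring
    refine HasDerivAt.congr_deriv
      (((hasDerivAt_arctan x).const_mul 0).add (hnum.div hden (by positivity))) ?_
    field_simp
    ring
  · exact Continuous.div (by fun_prop) (by fun_prop) fun x => by positivity
  · intro x hx
    have h := (hpos x).ne'
    have h' : x ^ 2 + 1 ≠ 0 := by positivity
    field_simp
    ring

theorem integral_phi2_b :
    ∫ x : ℝ, (((x : ℂ) * ((x : ℂ) ^ 2 - 1))) / (((x : ℂ) - I) ^ 5 * ((x : ℂ) + I) ^ 4) = -((π : ℂ) / 64) := by
  obtain ⟨hre, hre_eq⟩ := integral_sq_mul_sq_sub_one_div_one_add_sq_pow_five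
  obtain ⟨him, him_eq⟩ := integral_mul_sq_sub_one_div_one_add_sq_pow_five
  have hsplit (x : ℝ) :
      (((x : ℂ) * ((x : ℂ) ^ 2 - 1))) / (((x : ℂ) - I) ^ 5 * ((x : ℂ) + I) ^ 4) =
        ((x ^ 2 * (x ^ 2 - 1) / (1 + x ^ 2) ^ 5 : ℝ) : ℂ) +
          ((x * (x ^ 2 - 1) / (1 + x ^ 2) ^ 5 : ℝ) : ℂ) * I := by
    have hmul : (1 : ℂ) + (x : ℂ) ^ 2 = (x - I) * (x + I) := by
      linear_combination I_sq
    have hsub : (x : ℂ) - I ≠ 0 := fun h => by simpa using congrArg Complex.im h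
    have hadd : (x : ℂ) + I ≠ 0 := fun h => by simpa using congrArg Complex.im h
    push_cast
    rw [hmul]
    field_simp
  simp_rw [hsplit]
  have hre_ofReal : Integrable fun x : ℝ => ((x ^ 2 * (x ^ 2 - 1) / (1 + x ^ 2) ^ 5 : ℝ) : ℂ) :=
    hre.ofReal
  have him_ofReal : Integrable fun x : ℝ => ((x * (x ^ 2 - 1) / (1 + x ^ 2) ^ 5 : ℝ) : ℂ) :=
    him.ofReal
  rw [integral_add hre_ofReal (him_ofReal.mul_const I), integral_mul_const,
    integral_complex_ofReal, integral_complex_ofReal, hre_eq, him_eq]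
  push_cast
  ring
end

section
/- The Lebesgue integral over ℝ of the complex-valued function x ↦ x/((x−i)⁶(x+i)⁴) equals 7πi/128. -/
open Real Complex MeasureTheory

open Filter Topology Bornology

lemma ofReal_sub_ne_zero_of_im_ne_zero {a : ℂ} (ha : a.im ≠ 0) (x : ℝ) : (x : ℂ) - a ≠ 0 :=
  fun h => ha (by simpa using congrArg im h)

lemma hasDerivAt_inv_ofReal_sub_pow {a : ℂ} (ha : a.im ≠ 0) (n : ℕ) (x : ℝ) :
    HasDerivAt (fun y : ℝ => ((y : ℂ) - a)⁻¹ ^ n) (-(n * ((x : ℂ) - a)⁻¹ ^ (n + 1))) x := by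
  have h := (((hasDerivAt_id (x : ℂ)).sub_const a).inv
    (ofReal_sub_ne_zero_of_im_ne_zero ha x)).pow n
  refine h.comp_ofReal.congr_deriv ?_
  have := ofReal_sub_ne_zero_of_im_ne_zero ha x
  rcases n with _ | n
  · simp
  · simp
    field_simp
    ring

lemma tendsto_inv_sub_cobounded (a : ℂ) :
    Tendsto (fun z : ℂ => (z - a)⁻¹) (cobounded ℂ) (𝓝 0) :=
  tendsto_inv₀_cobounded.comp (tendsto_sub_const_cobounded a)

lemma norm_integrand_le (x : ℝ) :
    ‖(x : ℂ) / (((x : ℂ) - I) ^ 6 * ((x : ℂ) + I) ^ 4)‖ ≤ (1 + x ^ 2)⁻¹ := by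
  have h₁ : ‖(x : ℂ) - I‖ ^ 2 = 1 + x ^ 2 := by
    rw [Complex.sq_norm, normSq_apply]; simp; ring
  have h₂ : ‖(x : ℂ) + I‖ ^ 2 = 1 + x ^ 2 := by
    rw [Complex.sq_norm, normSq_apply]; simp; ring
  have h : ‖(x : ℂ) - I‖ ^ 6 * ‖(x : ℂ) + I‖ ^ 4 = (1 + x ^ 2) ^ 5 := by
    rw [pow_mul _ 2 3, pow_mul _ 2 2, h₁, h₂]; ring
  rw [norm_div, norm_mul, norm_pow, norm_pow, h, norm_real, Real.norm_eq_abs,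
    div_le_iff₀ (by positivity)]
  have hx : |x| ≤ 1 + x ^ 2 := by
    rw [← sq_abs]; nlinarith [sq_nonneg (|x| - 1), abs_nonneg x]
  calc |x| ≤ 1 + x ^ 2 := hx
    _ ≤ (1 + x ^ 2) ^ 4 := le_self_pow₀ (by nlinarith [sq_nonneg x]) (by norm_num)
    _ = (1 + x ^ 2)⁻¹ * (1 + x ^ 2) ^ 5 := by field_simp

lemma integrable_integrand :
    Integrable fun x : ℝ => (x : ℂ) / (((x : ℂ) - I) ^ 6 * ((x : ℂ) + I) ^ 4) := by
  refine integrable_inv_one_add_sq.mono' ?_ (.of_forall norm_integrand_le)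
  exact Measurable.aestronglyMeasurable (by fun_prop)

/-- The rational part of the antiderivative, in terms of `u = (x - I)⁻¹` and `v = (x + I)⁻¹`. -/
noncomputable def antiderivRationalPart (u v : ℂ) : ℂ :=
  5 * I / 256 * u ^ 1 + I / 96 * u ^ 3 + 1 / 64 * u ^ 4 - I / 80 * u ^ 5
    + 9 * I / 256 * v ^ 1 - 1 / 64 * v ^ 2 - I / 192 * v ^ 3

noncomputable def antideriv (x : ℝ) : ℂ :=
  7 * I / 128 * (Real.arctan x : ℂ) + antiderivRationalPart ((x : ℂ) - I)⁻¹ ((x : ℂ) - -I)⁻¹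

lemma hasDerivAt_antideriv (x : ℝ) :
    HasDerivAt antideriv ((x : ℂ) / (((x : ℂ) - I) ^ 6 * ((x : ℂ) + I) ^ 4)) x := by
  have hu := hasDerivAt_inv_ofReal_sub_pow (a := I) (by simp)
  have hv := hasDerivAt_inv_ofReal_sub_pow (a := -I) (by simp)
  have key := ((Real.hasDerivAt_arctan x).ofReal_comp.const_mul (7 * I / 128)).add
    (((((((hu 1 x).const_mul (5 * I / 256)).add ((hu 3 x).const_mul (I / 96))).add
      ((hu 4 x).const_mul (1 / 64))).sub ((hu 5 x).const_mul (I / 80))).add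
      ((hv 1 x).const_mul (9 * I / 256))).sub ((hv 2 x).const_mul (1 / 64)) |>.sub
      ((hv 3 x).const_mul (I / 192)))
  refine key.congr_deriv ?_
  have hs : (x : ℂ) - I ≠ 0 := ofReal_sub_ne_zero_of_im_ne_zero (by simp) x
  have ht : (x : ℂ) + I ≠ 0 := by
    simpa using ofReal_sub_ne_zero_of_im_ne_zero (a := -I) (by simp) x
  have hst : (1 : ℂ) + (x : ℂ) ^ 2 = ((x : ℂ) - I) * ((x : ℂ) + I) := by
    linear_combination I_sq
  push_cast
  rw [hst, sub_neg_eq_add]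
  have hI := I_sq
  generalize (x : ℂ) = z at *
  generalize I = i at *
  field_simp
  grind

lemma tendsto_antideriv {l : Filter ℝ} (hl : Tendsto ((↑) : ℝ → ℂ) l (cobounded ℂ)) {c : ℝ}
    (hc : Tendsto Real.arctan l (𝓝 c)) : Tendsto antideriv l (𝓝 (7 * I / 128 * c)) := by
  have hu := (tendsto_inv_sub_cobounded I).comp hl
  have hv := (tendsto_inv_sub_cobounded (-I)).comp hl
  have hr : Continuous fun p : ℂ × ℂ => antiderivRationalPart p.1 p.2 := by
    unfold antiderivRationalPart; fun_prop
  have h := (hr.tendsto' (0, 0) 0 (by simp [antiderivRationalPart])).comp (hu.prodMk_nhds hv)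
  rw [← add_zero (7 * I / 128 * (c : ℂ))]
  exact (((continuous_ofReal.tendsto c).comp hc).const_mul (7 * I / 128)).add h

theorem integral_phi3_c :
    ∫ x : ℝ, ((x : ℂ)) / (((x : ℂ) - I) ^ 6 * ((x : ℂ) + I) ^ 4) = 7 * (π : ℂ) * I / 128 := by
  rw [integral_of_hasDerivAt_of_tendsto hasDerivAt_antideriv integrable_integrand
    (tendsto_antideriv (RCLike.tendsto_ofReal_atBot_cobounded ℂ)
      (Real.tendsto_arctan_atBot.mono_right nhdsWithin_le_nhds))
    (tendsto_antideriv (RCLike.tendsto_ofReal_atTop_cobounded ℂ)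
      (Real.tendsto_arctan_atTop.mono_right nhdsWithin_le_nhds))]
  push_cast
  ring
end
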